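/- arXiv:2303.06307 — 6 statements merged into one kernel-verified Lean document; each statement's English description precedes it below -/
import Mathlib

section
/- Let (G,u,b) be an influence Fisher market with n buyers and m goods in which every budget b_i is strictly positive and, for every buyer i, u_i is continuous, is concave in the buyer's own bundle x_i for every fixed X_{-i}, and satisfies no saturation. Then a pair (X*, p*) ∈ ℝ_{≥0}^{n×m} × ℝ_{≥0}^m is a competitive equilibrium of the market if and only if it is a generalized Nash equilibrium of the associated auctioneer–buyer pseudo-game. -/
open Finset

/-- A maximizer of a concave function over a budget set exhausts the budget, provided that it is
not a maximizer over the whole nonnegative orthant. -/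
lemma sum_mul_eq_budget_of_concaveOn {ι : Type*} [Fintype ι] {f : (ι → ℝ) → ℝ}
    (hf : ConcaveOn ℝ {x : ι → ℝ | ∀ j, 0 ≤ x j} f) {p y z : ι → ℝ} {c : ℝ}
    (hp : ∀ j, 0 ≤ p j) (hy : ∀ j, 0 ≤ y j) (hz : ∀ j, 0 ≤ z j) (hyz : f y < f z)
    (hyc : ∑ j, y j * p j ≤ c)
    (hmax : ∀ x : ι → ℝ, (∀ j, 0 ≤ x j) → ∑ j, x j * p j ≤ c → f x ≤ f y) :
    ∑ j, y j * p j = c := by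
  by_contra hne
  have hlt : 0 < c - ∑ j, y j * p j := sub_pos.2 (lt_of_le_of_ne hyc hne)
  have hy0 : 0 ≤ ∑ j, y j * p j := sum_nonneg fun j _ => mul_nonneg (hy j) (hp j)
  have hz0 : 0 ≤ ∑ j, z j * p j := sum_nonneg fun j _ => mul_nonneg (hz j) (hp j)
  set s := ∑ j, y j * p j with hs
  set r := ∑ j, z j * p j with hr
  set t := (c - s) / ((c - s) + r) with ht
  have ht0 : 0 < t := by positivity
  have ht1 : t ≤ 1 := (div_le_one (by positivity)).2 (by linarith)
  have htr : t * ((c - s) + r) = c - s := div_mul_cancel₀ _ (by positivity)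
  have hcost : ∑ j, ((1 - t) • y + t • z) j * p j = (1 - t) * s + t * r := by
    simp only [hs, hr, mul_sum, ← sum_add_distrib, Pi.add_apply, Pi.smul_apply, smul_eq_mul]
    exact sum_congr rfl fun j _ => by ring
  have hle := hmax ((1 - t) • y + t • z)
    (fun j => add_nonneg (mul_nonneg (by linarith) (hy j)) (mul_nonneg ht0.le (hz j)))
    (by rw [hcost]; nlinarith)
  have hge := hf.2 hy hz (sub_nonneg.2 ht1) ht0.le (by ring)
  simp only [smul_eq_mul] at hge
  nlinarith

/-- In an influence Fisher market with strictly positive budgets whose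
utilities are continuous, concave in the buyer's own bundle, and satisfy no
saturation, a pair `(X*, p*)` of nonnegative allocation and prices is a competitive
equilibrium iff it is a generalized Nash equilibrium of the auctioneer–buyer
pseudo-game. -/
theorem competitive_equilibrium_iff_GNE
    (n m : ℕ)
    (u : Fin n → (Fin n → Fin m → ℝ) → ℝ)
    (b : Fin n → ℝ)
    (hb : ∀ i, 0 < b i)
    (hcont : ∀ i, ContinuousOn (u i) {X : Fin n → Fin m → ℝ | ∀ k j, 0 ≤ X k j})
    (hconc : ∀ i (X : Fin n → Fin m → ℝ), (∀ k j, 0 ≤ X k j) →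
      ConcaveOn ℝ {x : Fin m → ℝ | ∀ j, 0 ≤ x j}
        (fun x => u i (Function.update X i x)))
    (hnosat : ∀ i (X : Fin n → Fin m → ℝ), (∀ k j, 0 ≤ X k j) →
      ∃ x' : Fin m → ℝ, (∀ j, 0 ≤ x' j) ∧ u i X < u i (Function.update X i x'))
    (Xs : Fin n → Fin m → ℝ) (ps : Fin m → ℝ)
    (hXs : ∀ k j, 0 ≤ Xs k j) (hps : ∀ j, 0 ≤ ps j) :
    -- competitive equilibrium of the market
    ((∀ i, (∑ j, Xs i j * ps j ≤ b i) ∧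
        ∀ x : Fin m → ℝ, (∀ j, 0 ≤ x j) → (∑ j, x j * ps j ≤ b i) →
          u i (Function.update Xs i x) ≤ u i Xs) ∧
      (∀ j, ∑ i, Xs i j ≤ 1) ∧
      (∑ j, ps j * ((∑ i, Xs i j) - 1) = 0))
    ↔
    -- generalized Nash equilibrium of the auctioneer–buyer pseudo-game
    ((∑ j, ps j = ∑ i, b i) ∧
      (∀ i, (∑ j, Xs i j * ps j ≤ b i) ∧
        ∀ x : Fin m → ℝ, (∀ j, 0 ≤ x j) → (∑ j, x j * ps j ≤ b i) →
          u i (Function.update Xs i x) ≤ u i Xs) ∧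
      (∀ p : Fin m → ℝ, (∀ j, 0 ≤ p j) → (∑ j, p j = ∑ i, b i) →
        ∑ j, p j * ((∑ i, Xs i j) - 1) ≤ ∑ j, ps j * ((∑ i, Xs i j) - 1))) := by
  have budget_exhausted : (∀ i, (∑ j, Xs i j * ps j ≤ b i) ∧
      ∀ x : Fin m → ℝ, (∀ j, 0 ≤ x j) → (∑ j, x j * ps j ≤ b i) →
        u i (Function.update Xs i x) ≤ u i Xs) →
      ∑ j, ps j * ((∑ i, Xs i j) - 1) = ∑ i, b i - ∑ j, ps j := by
    intro hopt
    have hspend : ∀ i, ∑ j, Xs i j * ps j = b i := fun i => by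
      obtain ⟨z, hz, hlt⟩ := hnosat i Xs hXs
      exact sum_mul_eq_budget_of_concaveOn (hconc i Xs hXs) hps (hXs i) hz
        (by simpa using hlt) (hopt i).1 (by simpa using (hopt i).2)
    simp only [← hspend, mul_sub, mul_one, sum_sub_distrib, mul_sum]
    rw [sum_comm]
    simp only [mul_comm]
  constructor
  · rintro ⟨hopt, hfeas, hwalras⟩
    refine ⟨by linarith [budget_exhausted hopt], hopt, fun p hp _ => ?_⟩
    rw [hwalras]
    exact sum_nonpos fun j _ => mul_nonpos_of_nonneg_of_nonpos (hp j) (sub_nonpos.2 (hfeas j))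
  · rintro ⟨hsum, hopt, hmax⟩
    have hwalras : ∑ j, ps j * ((∑ i, Xs i j) - 1) = 0 := by
      rw [budget_exhausted hopt, hsum, sub_self]
    refine ⟨hopt, fun j => ?_, hwalras⟩
    rcases isEmpty_or_nonempty (Fin n) with hn | hn
    · simp
    have hpos : 0 < ∑ i, b i := sum_pos (fun i _ => hb i) univ_nonempty
    have hle := hmax (Pi.single j (∑ i, b i)) (fun k => by rw [Pi.single_apply]; split_ifs <;> linarith)
      (by simp)
    simp only [hwalras, Pi.single_apply, ite_mul, zero_mul, sum_ite_eq', mem_univ, if_true] at hle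
    exact sub_nonpos.1 (nonpos_of_mul_nonpos_right hle hpos)
end

section
/- Let (G,u,b) be an influence Fisher market with n buyers and m goods in which every budget b_i is strictly positive and, for every buyer i, u_i is continuous, is concave in the buyer's own bundle x_i for every fixed X_{-i}, and satisfies no saturation. Then there exists a competitive equilibrium (X*, p*) ∈ ℝ_{≥0}^{n×m} × ℝ_{≥0}^m of the market. -/
open Finset

section Brouwer

open MeasureTheory Set
open scoped NNReal Topology

/-- Extending by zero a Lipschitz function on a closed ball that vanishes on the sphere gives a
Lipschitz function. -/
theorem LipschitzOnWith.indicator_closedBall {F : Type*} [NormedAddCommGroup F]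
    [NormedSpace ℝ F] {g : F → F} {C : ℝ≥0} {R : ℝ}
    (hg : LipschitzOnWith C g (Metric.closedBall 0 R)) (h0 : ∀ x : F, ‖x‖ = R → g x = 0) :
    LipschitzWith C ((Metric.closedBall (0 : F) R).indicator g) := by
  have key : ∀ x ∈ Metric.closedBall (0 : F) R, ∀ y ∉ Metric.closedBall (0 : F) R,
      dist (g x) 0 ≤ C * dist x y := by
    intro x hx y hy
    simp only [mem_closedBall_zero_iff, not_le] at hx hy
    have hcont : ContinuousOn (fun t : ℝ => ‖AffineMap.lineMap x y t‖) (Icc 0 1) := by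
      apply Continuous.continuousOn
      exact (AffineMap.lineMap_continuous).norm
    obtain ⟨t, ht, hz⟩ := intermediate_value_Icc zero_le_one hcont
      (show R ∈ Set.Icc _ _ by simpa using ⟨hx, hy.le⟩)
    calc dist (g x) 0 = dist (g x) (g (AffineMap.lineMap x y t)) := by rw [h0 _ hz]
      _ ≤ C * dist x (AffineMap.lineMap x y t) :=
        hg.dist_le_mul _ (by simpa using hx) _ (by simpa using hz.le)
      _ ≤ C * dist x y := by
        gcongr
        rw [dist_left_lineMap, Real.norm_of_nonneg ht.1]
        exact mul_le_of_le_one_left dist_nonneg ht.2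
  refine LipschitzWith.of_dist_le_mul fun x y => ?_
  by_cases hx : x ∈ Metric.closedBall (0 : F) R <;> by_cases hy : y ∈ Metric.closedBall (0 : F) R
  · simpa [hx, hy] using hg.dist_le_mul x hx y hy
  · rw [indicator_of_mem hx, indicator_of_notMem hy]
    exact key x hx y hy
  · rw [indicator_of_notMem hx, indicator_of_mem hy, dist_comm, dist_comm x y]
    exact key y hy x hx
  · simp only [indicator_of_notMem hx, indicator_of_notMem hy, dist_self]
    positivity

variable {E : Type*} [NormedAddCommGroup E] [InnerProductSpace ℝ E] [FiniteDimensional ℝ E]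

/-- A perturbation of the identity by an operator of norm less than one has positive
determinant. -/
theorem ContinuousLinearMap.det_one_add_pos {A : E →L[ℝ] E} (hA : ‖A‖ < 1) :
    0 < (1 + A).det := by
  by_contra! h
  have hcont : ContinuousOn (fun s : ℝ => (1 + s • A).det) (Icc 0 1) :=
    (ContinuousLinearMap.continuous_det.comp (by fun_prop)).continuousOn
  obtain ⟨s, ⟨hs0, hs1⟩, hs⟩ := intermediate_value_Icc' zero_le_one hcont
    (show (0 : ℝ) ∈ Set.Icc _ _ from ⟨by simpa using h, by simp [ContinuousLinearMap.det]⟩)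
  have hker := LinearMap.bot_lt_ker_of_det_eq_zero hs
  obtain ⟨v, hv, hv0⟩ := (Submodule.ne_bot_iff _).1 hker.ne'
  have hv' : v = -(s • A v) := by
    have : v + s • A v = 0 := by simpa using hv
    exact eq_neg_of_add_eq_zero_left this
  have h1 : ‖v‖ ≤ ‖A‖ * ‖v‖ := by
    calc ‖v‖ = s * ‖A v‖ := by
          conv_lhs => rw [hv', norm_neg, norm_smul, Real.norm_of_nonneg hs0]
      _ ≤ 1 * ‖A v‖ := by gcongr
      _ ≤ ‖A‖ * ‖v‖ := by rw [one_mul]; exact A.le_opNorm v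
  have h2 : 0 < ‖v‖ := norm_pos_iff.2 hv0
  nlinarith

/-- Along the line `t ↦ 1 + t • A`, the determinant is a polynomial of degree at most the
dimension. -/
theorem LinearMap.exists_polynomial_det_one_add_smul (A : E →ₗ[ℝ] E) :
    ∃ p : Polynomial ℝ, p.natDegree ≤ Module.finrank ℝ E ∧
      ∀ t : ℝ, p.eval t = LinearMap.det (1 + t • A) := by
  classical
  let b := Module.finBasis ℝ E
  let M := LinearMap.toMatrix b b A
  refine ⟨Matrix.det ((Polynomial.X : Polynomial ℝ) • M.map Polynomial.C
    + (1 : Matrix _ _ ℝ).map Polynomial.C), ?_, fun t => ?_⟩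
  · simpa using Polynomial.natDegree_det_X_add_C_le M 1
  · rw [← LinearMap.det_toMatrix b, ← Polynomial.coe_evalRingHom, RingHom.map_det]
    congr 1
    ext i j
    simp [M, Matrix.one_apply, LinearMap.toMatrix_apply, Finsupp.single_apply,
      apply_ite, add_comm, eq_comm]
    ring

/-- Extrapolation: the value at `1` of a polynomial of bounded degree is a fixed linear combination
of its values at points of `(0, ε]`. -/
theorem Polynomial.exists_eval_one_eq_sum (d : ℕ) {ε : ℝ} (hε : 0 < ε) :
    ∃ (v w : ℕ → ℝ), (∀ i ∈ Finset.range (d + 1), 0 < v i ∧ v i ≤ ε) ∧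
      ∀ p : Polynomial ℝ, p.natDegree ≤ d →
        p.eval 1 = ∑ i ∈ Finset.range (d + 1), w i * p.eval (v i) := by
  have hv : Function.Injective (fun i : ℕ => ε / (i + 1)) := by
    intro i j hij
    have hi : (0 : ℝ) < i + 1 := by positivity
    have hj : (0 : ℝ) < j + 1 := by positivity
    have h : ε * (j + 1) = ε * (i + 1) := by
      simpa [div_eq_div_iff hi.ne' hj.ne'] using hij
    have := mul_left_cancel₀ hε.ne' h
    exact_mod_cast (add_right_cancel this).symm
  refine ⟨fun i => ε / (i + 1),
    fun i => (Lagrange.basis (Finset.range (d + 1)) (fun i : ℕ => ε / (i + 1)) i).eval 1,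
    fun i _ => ⟨by positivity, div_le_self hε.le (by simp)⟩, fun p hp => ?_⟩
  have hdeg : p.degree < (Finset.range (d + 1)).card := by
    rw [Finset.card_range]
    exact Polynomial.degree_le_natDegree.trans_lt (by exact_mod_cast Nat.lt_succ_of_le hp)
  conv_lhs => rw [Lagrange.eq_interpolate (hv.injOn) hdeg, Lagrange.interpolate_apply,
    Polynomial.eval_finsetSum]
  simp [mul_comm]

/-- A small enough multiple of a Lipschitz map vanishing outside a set perturbs the identity
to a bijection of that set. -/
theorem LipschitzWith.bijOn_add_smul {g : E → E} {C : ℝ≥0} (hg : LipschitzWith C g) {s : Set E}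
    (h0 : ∀ x ∉ s, g x = 0) {t : ℝ} (ht0 : 0 ≤ t) (ht : t * C < 1) :
    BijOn (fun x => x + t • g x) s s := by
  have hinj : Function.Injective (fun x => x + t • g x) := by
    intro x y hxy
    have h1 : x - y = t • (g y - g x) := by
      rw [smul_sub, sub_eq_sub_iff_add_eq_add]
      simpa [add_comm] using hxy
    have h2 : dist x y ≤ t * C * dist x y := by
      calc dist x y = t * dist (g y) (g x) := by
            rw [dist_eq_norm, h1, norm_smul, Real.norm_of_nonneg ht0, dist_eq_norm]
        _ ≤ t * (C * dist y x) := by gcongr; exact hg.dist_le_mul _ _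
        _ = t * C * dist x y := by rw [dist_comm]; ring
    have h3 : 0 ≤ dist x y := dist_nonneg
    exact dist_eq_zero.1 (by nlinarith)
  refine ⟨fun x hx => ?_, hinj.injOn, fun y hy => ?_⟩
  · by_contra hn
    have h1 := @hinj x (x + t • g x) (by simp [h0 _ hn])
    exact hn (by simpa only [← h1] using hx)
  · let K : ℝ≥0 := ⟨t * C, by positivity⟩
    have hK : ContractingWith K (fun x => y - t • g x) := by
      refine ⟨by exact_mod_cast ht, LipschitzWith.of_dist_le_mul fun a b => ?_⟩
      rw [dist_sub_left, dist_smul₀, Real.norm_of_nonneg ht0]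
      calc t * dist (g a) (g b) ≤ t * (C * dist a b) := by gcongr; exact hg.dist_le_mul _ _
        _ = K * dist a b := (mul_assoc _ _ _).symm
    have hfix : y - t • g (ContractingWith.fixedPoint _ hK) = ContractingWith.fixedPoint _ hK :=
      hK.fixedPoint_isFixedPt
    set z := ContractingWith.fixedPoint _ hK
    have hyz : z + t • g z = y := by rw [← sub_eq_iff_eq_add.1 hfix]
    refine ⟨z, ?_, hyz⟩
    by_contra hn
    rw [h0 z hn] at hyz
    rw [smul_zero, add_zero] at hyz
    exact hn (hyz ▸ hy)

/-- The no-retraction theorem for continuously differentiable maps. -/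
theorem not_contDiff_retraction_sphere {r : E → E} {R : ℝ} (hR : 0 < R) (hr : ContDiff ℝ 1 r)
    (hnorm : ∀ x, ‖r x‖ = R) (hid : ∀ x, ‖x‖ = R → r x = x) : False := by
  borelize E
  let B : Set E := Metric.closedBall 0 R
  let D : E → E →L[ℝ] E := fun x => fderiv ℝ r x - 1
  have hD : Continuous D := (hr.continuous_fderiv one_ne_zero).sub continuous_const
  have hg : ∀ x, HasFDerivAt (fun x => r x - x) (D x) x := fun x =>
    ((hr.differentiable one_ne_zero) x).hasFDerivAt.sub (hasFDerivAt_id x)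
  have hBc : IsCompact B := isCompact_closedBall 0 R
  obtain ⟨C, hC⟩ : ∃ C : ℝ≥0, ∀ x ∈ B, ‖D x‖₊ ≤ C := by
    obtain ⟨c, hc⟩ := (hBc.bddAbove_image (f := fun x => ‖D x‖₊) hD.nnnorm.continuousOn)
    exact ⟨c, fun x hx => hc (mem_image_of_mem _ hx)⟩
  have hlip : LipschitzOnWith C (fun x => r x - x) B :=
    (convex_closedBall 0 R).lipschitzOnWith_of_nnnorm_hasFDerivWithin_le
      (fun x _ => (hg x).hasFDerivWithinAt) hC
  have hext := hlip.indicator_closedBall (fun x hx => by simp [hid x hx])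
  let ε : ℝ := 1 / (C + 1)
  have hε : 0 < ε := by positivity
  have hεC : ∀ t, t ≤ ε → t * C < 1 := fun t ht => by
    calc t * C ≤ ε * C := by gcongr
      _ < 1 := by
        rw [one_div_mul_eq_div, div_lt_one (by positivity)]
        linarith
  have hcontdet : ∀ t : ℝ, Continuous fun x => (1 + t • D x).det := fun t =>
    ContinuousLinearMap.continuous_det.comp (by fun_prop)
  have hint : ∀ t : ℝ, IntegrableOn (fun x => (1 + t • D x).det) B volume := fun t =>
    (hcontdet t).continuousOn.integrableOn_compact hBc
  have hvol : ∀ t, 0 < t → t ≤ ε → ∫ x in B, (1 + t • D x).det = volume.real B := by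
    intro t ht0 ht
    have hbij : BijOn (fun x => x + t • (r x - x)) B B := by
      refine (hext.bijOn_add_smul (s := B) (fun x hx => indicator_of_notMem hx _) ht0.le
        (hεC t ht)).congr fun x hx => ?_
      simp only [B] at hx
      simp [indicator_of_mem hx]
    have hder : ∀ x ∈ B, HasFDerivWithinAt (fun x => x + t • (r x - x)) (1 + t • D x) B x :=
      fun x _ => ((hasFDerivAt_id x).add ((hg x).const_smul t)).hasFDerivWithinAt
    have hpos : ∀ x ∈ B, 0 < (1 + t • D x).det := fun x hx => by
      refine ContinuousLinearMap.det_one_add_pos ?_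
      rw [norm_smul, Real.norm_of_nonneg ht0.le]
      have : ‖D x‖ ≤ C := by exact_mod_cast hC x hx
      exact (mul_le_mul_of_nonneg_left this ht0.le).trans_lt (hεC t ht)
    have hcv := integral_image_eq_integral_abs_det_fderiv_smul volume
      Metric.isClosed_closedBall.measurableSet hder hbij.injOn (fun _ => (1 : ℝ))
    rw [hbij.image_eq] at hcv
    simp only [integral_const, smul_eq_mul, mul_one, measureReal_restrict_apply_univ] at hcv
    rw [hcv]
    exact setIntegral_congr_fun Metric.isClosed_closedBall.measurableSet
      fun x hx => (abs_of_pos (hpos x hx)).symm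
  obtain ⟨v, w, hv, hw⟩ := Polynomial.exists_eval_one_eq_sum (Module.finrank ℝ E) hε
  have hsumw : ∑ i ∈ Finset.range (Module.finrank ℝ E + 1), w i = 1 := by
    simpa using (hw 1 (by simp)).symm
  have hext1 : ∀ x, (1 + (1 : ℝ) • D x).det
      = ∑ i ∈ Finset.range (Module.finrank ℝ E + 1), w i * (1 + v i • D x).det := by
    intro x
    obtain ⟨p, hp, hpe⟩ := LinearMap.exists_polynomial_det_one_add_smul (D x : E →ₗ[ℝ] E)
    have := hw p hp
    simp only [hpe] at this
    simpa [ContinuousLinearMap.det] using this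
  have htotal : ∫ x in B, (1 + (1 : ℝ) • D x).det = volume.real B := by
    simp_rw [hext1]
    rw [integral_finsetSum _ fun i _ => (hint _).const_mul _]
    simp_rw [integral_const_mul]
    rw [Finset.sum_congr rfl fun i hi => by rw [hvol _ (hv i hi).1 (hv i hi).2],
      ← Finset.sum_mul, hsumw, one_mul]
  have hzero : ∀ x, (1 + (1 : ℝ) • D x).det = 0 := by
    intro x
    have h1 : (1 + (1 : ℝ) • D x) = fderiv ℝ r x := by simp [D]
    rw [h1]
    by_contra hne
    have hsurj : Function.Surjective (fderiv ℝ r x) := by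
      have hu : IsUnit (fderiv ℝ r x : E →ₗ[ℝ] E) :=
        LinearMap.isUnit_iff_isUnit_det _ |>.2 (isUnit_iff_ne_zero.2 hne)
      exact ((Module.End.isUnit_iff _).1 hu).2
    obtain ⟨y, hy⟩ := hsurj (r x)
    have hd := ((hr.differentiable one_ne_zero) x).hasFDerivAt
    have hd2 := (hd.inner ℝ hd)
    have hconst : (fun y => inner ℝ (r y) (r y)) = fun _ => R ^ 2 := by
      funext y; rw [real_inner_self_eq_norm_sq, hnorm]
    rw [hconst] at hd2
    have h0 := hd2.unique (hasFDerivAt_const _ _)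
    have h2 := congrArg (fun L => L y) h0
    simp [hy, hnorm] at h2
    exact hR.ne' h2
  have hBpos : 0 < volume.real B := by
    refine ENNReal.toReal_pos ?_ hBc.measure_lt_top.ne
    exact (Metric.measure_closedBall_pos volume 0 hR).ne'
  simp only [hzero, integral_zero] at htotal
  exact hBpos.ne htotal

/-- Brouwer's fixed point theorem for bounded continuous self-maps of a finite-dimensional
space. -/
theorem Continuous.exists_fixedPoint_of_bounded {G : E → E} (hG : Continuous G) {M : ℝ}
    (hM : ∀ x, ‖G x‖ ≤ M) : ∃ x, G x = x := by
  by_contra! hne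
  have hM0 : 0 ≤ M := (norm_nonneg _).trans (hM 0)
  let B : Set E := Metric.closedBall 0 (M + 2)
  have hB : IsCompact B := isCompact_closedBall 0 _
  obtain ⟨x₀, -, hx₀⟩ := hB.exists_isMinOn ⟨0, by simp [B]; positivity⟩
    (f := fun x => dist (G x) x) (by fun_prop)
  let δ := min (dist (G x₀) x₀) 1
  have hδ : 0 < δ := lt_min (dist_pos.2 (hne x₀)) one_pos
  obtain ⟨h, hh, hd, -⟩ := hG.exists_contDiff_approx (ε := fun _ => δ) 1 continuous_const
    fun _ => hδ
  let χ : ContDiffBump (0 : E) := ⟨M + 1, M + 2, by positivity, by linarith⟩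
  let f : E → E := fun x => x - χ x • h x
  have hf : ContDiff ℝ 1 f := contDiff_id.sub (χ.contDiff.smul hh)
  have hfout : ∀ x, M + 2 ≤ ‖x‖ → f x = x := fun x hx => by
    have : χ x = 0 := χ.zero_of_le_dist (by simpa using hx)
    simp [f, this]
  have hf0 : ∀ x, f x ≠ 0 := by
    intro x hx
    have hxB : ‖x‖ < M + 2 := by
      by_contra! hn
      rw [hfout x hn] at hx
      simp [hx] at hn
      linarith
    have hx' : x = χ x • h x := sub_eq_zero.1 hx
    have hnx : ‖x‖ ≤ M + 1 := by
      have h1 : ‖h x‖ ≤ M + 1 := by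
        have h2 := hd x
        rw [dist_eq_norm] at h2
        have h3 := norm_le_norm_add_norm_sub' (h x) (G x)
        have h4 : δ ≤ 1 := min_le_right _ _
        linarith [hM x]
      calc ‖x‖ = χ x * ‖h x‖ := by
            conv_lhs => rw [hx', norm_smul, Real.norm_of_nonneg χ.nonneg]
        _ ≤ 1 * ‖h x‖ := by gcongr; exact χ.le_one
        _ ≤ M + 1 := by linarith
    have hone : χ x = 1 := χ.one_of_mem_closedBall (by simpa using hnx)
    rw [hone, one_smul] at hx'
    have h5 : dist (G x₀) x₀ ≤ dist (G x) x := hx₀ (by simpa [B] using hxB.le)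
    have h6 := hd x
    rw [← hx', dist_comm] at h6
    have h7 : δ ≤ dist (G x₀) x₀ := min_le_left _ _
    linarith
  have hR : 0 < M + 2 := by positivity
  refine not_contDiff_retraction_sphere (r := fun x => ((M + 2) / ‖f x‖) • f x) hR ?_ ?_ ?_
  · exact (contDiff_const.div (hf.norm ℝ hf0) fun x => norm_ne_zero_iff.2 (hf0 x)).smul hf
  · intro x
    rw [norm_smul, Real.norm_of_nonneg (by positivity),
      div_mul_cancel₀ _ (norm_ne_zero_iff.2 (hf0 x))]
  · intro x hx
    simp only [hfout x hx.ge, hx, div_self hR.ne', one_smul]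

/-- Brouwer's fixed point theorem on a box. -/
theorem ContinuousOn.exists_fixedPoint_Icc {ι : Type*} [Fintype ι] {a b : ι → ℝ} (hab : a ≤ b)
    {f : (ι → ℝ) → ι → ℝ} (hf : ContinuousOn f (Icc a b)) (hmaps : MapsTo f (Icc a b) (Icc a b)) :
    ∃ x ∈ Icc a b, f x = x := by
  let π : (ι → ℝ) → ι → ℝ := fun x i => max (a i) (min (x i) (b i))
  have hπ : ∀ x, π x ∈ Icc a b := fun x => 
    ⟨fun _ => le_max_left _ _, fun i => max_le (hab i) (min_le_right _ _)⟩
  have hπc : Continuous π := by fun_prop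
  let e := EuclideanSpace.equiv ι ℝ
  let G : EuclideanSpace ℝ ι → EuclideanSpace ℝ ι := fun x => e.symm (f (π (e x)))
  have hG : Continuous G := e.symm.continuous.comp
    (hf.comp_continuous (hπc.comp e.continuous) fun x => hπ _)
  obtain ⟨M, hM⟩ := (isCompact_Icc.image e.symm.continuous).isBounded.exists_norm_le
    (s := e.symm '' Icc a b)
  obtain ⟨x, hx⟩ := hG.exists_fixedPoint_of_bounded
    fun x => hM _ (mem_image_of_mem _ (hmaps (hπ (e x))))
  have hx' : f (π (e x)) = e x := by
    have := congrArg e hx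
    simpa [G] using this
  have hmem : e x ∈ Icc a b := hx' ▸ hmaps (hπ (e x))
  refine ⟨e x, hmem, ?_⟩
  have : π (e x) = e x := by
    funext i
    simp only [π]
    rw [min_eq_left (hmem.2 i), max_eq_right (hmem.1 i)]
  rwa [this] at hx'

end Brouwer

section QuasiEquilibrium

open Set Filter
open scoped Topology

variable {ι : Type*} [Fintype ι]

/-- Subtracting a proximal term from a concave function makes its maximizer on a convex set
unique. -/
theorem ConcaveOn.eq_of_isMaxOn_sub_sum_sq {s : Set (ι → ℝ)} {f : (ι → ℝ) → ℝ}
    (hf : ConcaveOn ℝ s f) (x : ι → ℝ) {y z : ι → ℝ} (hy : y ∈ s) (hz : z ∈ s)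
    (hymax : IsMaxOn (fun w => f w - ∑ i, (w i - x i) ^ 2) s y)
    (hzmax : IsMaxOn (fun w => f w - ∑ i, (w i - x i) ^ 2) s z) : y = z := by
  have h_half : (0 : ℝ) ≤ 1 / 2 := by norm_num
  have hmid := hf.1 hy hz h_half h_half (add_halves 1)
  have hval := hf.2 hy hz h_half h_half (add_halves 1)
  have h1 := hymax hmid
  have h2 := hzmax hmid
  simp only [mem_ofPred_eq, smul_eq_mul, Pi.add_apply, Pi.smul_apply] at h1 h2 hval
  have hpar : ∑ i, (1 / 2 * y i + 1 / 2 * z i - x i) ^ 2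
      = 1 / 2 * ∑ i, (y i - x i) ^ 2 + 1 / 2 * ∑ i, (z i - x i) ^ 2
        - 1 / 4 * ∑ i, (y i - z i) ^ 2 := by
    simp only [Finset.mul_sum, ← Finset.sum_add_distrib, ← Finset.sum_sub_distrib]
    exact Finset.sum_congr rfl fun i _ => by ring
  have hle : ∑ i, (y i - z i) ^ 2 ≤ 0 := by linarith
  have heq := (Finset.sum_eq_zero_iff_of_nonneg fun i _ => sq_nonneg _).1
    (hle.antisymm (Finset.sum_nonneg fun i _ => sq_nonneg (y i - z i)))
  funext i
  exact sub_eq_zero.1 (pow_eq_zero_iff two_ne_zero |>.1 (heq i (Finset.mem_univ i)))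

/-- If a point of a convex set maximizes a concave function penalized by the squared distance
to that point, then it maximizes the function itself. -/
theorem ConcaveOn.isMaxOn_of_isMaxOn_sub_sum_sq {s : Set (ι → ℝ)} {f : (ι → ℝ) → ℝ}
    (hf : ConcaveOn ℝ s f) {x : ι → ℝ} (hx : x ∈ s)
    (hmax : IsMaxOn (fun w => f w - ∑ i, (w i - x i) ^ 2) s x) : IsMaxOn f s x := by
  intro y hy
  by_contra! hlt
  have hlt' : f x < f y := by simpa using hlt
  set c := ∑ i, (y i - x i) ^ 2 with hc
  have hc0 : 0 ≤ c := Finset.sum_nonneg fun i _ => sq_nonneg _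
  set g := f y - f x with hg
  have hg0 : 0 < g := sub_pos.2 hlt'
  set t := g / (g + c) with ht
  have ht0 : 0 < t := by positivity
  have ht1 : t ≤ 1 := by rw [ht, div_le_one (by positivity)]; linarith
  have htg : t * (g + c) = g := div_mul_cancel₀ _ (by positivity)
  have hmem := hf.1 hx hy (sub_nonneg.2 ht1) ht0.le (sub_add_cancel 1 t)
  have hval := hf.2 hx hy (sub_nonneg.2 ht1) ht0.le (sub_add_cancel 1 t)
  have h1 := hmax hmem
  simp only [mem_ofPred_eq, smul_eq_mul, Pi.add_apply, Pi.smul_apply, sub_self] at h1 hval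
  have hsq : ∑ i, ((1 - t) * x i + t * y i - x i) ^ 2 = t ^ 2 * c := by
    rw [hc, Finset.mul_sum]
    exact Finset.sum_congr rfl fun i _ => by ring
  rw [hsq] at h1
  have h2 : t * g ≤ t * (t * c) := by
    simp at h1
    nlinarith
  have h3 := le_of_mul_le_mul_left h2 ht0
  nlinarith

/-- Existence of a quasi-variational equilibrium on a box: for a continuous correspondence `Φ` with
convex values and an objective `F` that is concave in the second variable, some `x` maximizes
`F x` over `Φ x`. -/
theorem exists_isMaxOn_self_of_concaveOn {a b : ι → ℝ} (hab : a ≤ b)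
    {Φ : (ι → ℝ) → Set (ι → ℝ)} {F : (ι → ℝ) → (ι → ℝ) → ℝ}
    (hsub : ∀ x ∈ Icc a b, Φ x ⊆ Icc a b) (hne : ∀ x ∈ Icc a b, (Φ x).Nonempty)
    (hclosed : IsClosed {p : (ι → ℝ) × (ι → ℝ) | p.1 ∈ Icc a b ∧ p.2 ∈ Φ p.1})
    (hlsc : ∀ x ∈ Icc a b, ∀ y ∈ Φ x, ∃ s : (ι → ℝ) → ι → ℝ,
      ContinuousWithinAt s (Icc a b) x ∧ s x = y ∧ ∀ z ∈ Icc a b, s z ∈ Φ z)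
    (hF : ContinuousOn (fun p : (ι → ℝ) × (ι → ℝ) => F p.1 p.2) (Icc a b ×ˢ Icc a b))
    (hconc : ∀ x ∈ Icc a b, ConcaveOn ℝ (Φ x) (F x)) :
    ∃ x ∈ Icc a b, x ∈ Φ x ∧ IsMaxOn (F x) (Φ x) x := by
  let H : (ι → ℝ) → (ι → ℝ) → ℝ := fun x y => F x y - ∑ i, (y i - x i) ^ 2
  have hH : ContinuousOn (fun p : (ι → ℝ) × (ι → ℝ) => H p.1 p.2) (Icc a b ×ˢ Icc a b) :=
    hF.sub (by fun_prop)
  have hcpt : ∀ x ∈ Icc a b, IsCompact (Φ x) := fun x hx => by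
    refine isCompact_Icc.of_isClosed_subset ?_ (hsub x hx)
    have := hclosed.preimage (f := fun y : ι → ℝ => (x, y)) (by fun_prop)
    simpa [Set.preimage, hx.1, hx.2] using this
  have hmax : ∀ x ∈ Icc a b, ∃ y ∈ Φ x, IsMaxOn (H x) (Φ x) y := fun x hx =>
    (hcpt x hx).exists_isMaxOn (hne x hx) <| hH.comp (f := fun y : ι → ℝ => (x, y))
      (by fun_prop) fun y hy => ⟨hx, hsub x hx hy⟩
  choose! φ hφ hφmax using hmax
  have hφK : ∀ x ∈ Icc a b, φ x ∈ Icc a b := fun x hx => hsub x hx (hφ x hx)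
  have hcont : ContinuousOn φ (Icc a b) := by
    intro x hx
    refine isCompact_Icc.tendsto_nhds_of_unique_mapClusterPt
      (eventually_mem_nhdsWithin.mono hφK) fun y hyK hy => ?_
    obtain ⟨U, hU, hUy⟩ := mapClusterPt_iff_ultrafilter.1 hy
    have hUK : ∀ᶠ z in (U : Filter (ι → ℝ)), z ∈ Icc a b := hU eventually_mem_nhdsWithin
    have hUx : Tendsto id (U : Filter (ι → ℝ)) (𝓝 x) := hU.trans nhdsWithin_le_nhds
    have hyΦ : y ∈ Φ x :=
      (hclosed.mem_of_tendsto (hUx.prodMk_nhds hUy) (hUK.mono fun z hz => ⟨hz, hφ z hz⟩)).2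
    refine (hconc x hx).eq_of_isMaxOn_sub_sum_sq x hyΦ (hφ x hx) (fun w hw => ?_) (hφmax x hx)
    obtain ⟨s, hs, hsx, hsΦ⟩ := hlsc x hx w hw
    have hsw : Tendsto s (U : Filter (ι → ℝ)) (𝓝 w) := hsx ▸ (hs.mono_left hU)
    have hlim : ∀ {v : (ι → ℝ) → ι → ℝ} {l : ι → ℝ}, l ∈ Icc a b →
        (∀ z ∈ Icc a b, v z ∈ Icc a b) → Tendsto v (U : Filter (ι → ℝ)) (𝓝 l) →
        Tendsto (fun z => H z (v z)) (U : Filter (ι → ℝ)) (𝓝 (H x l)) := by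
      intro v l hl hv hvl
      refine (hH (x, l) ⟨hx, hl⟩).tendsto.comp (tendsto_nhdsWithin_iff.2
        ⟨hUx.prodMk_nhds hvl, hUK.mono fun z hz => ⟨hz, hv z hz⟩⟩)
    exact le_of_tendsto_of_tendsto
      (hlim (hsub x hx hw) (fun z hz => hsub z hz (hsΦ z hz)) hsw) (hlim hyK hφK hUy)
      (hUK.mono fun z hz => hφmax z hz (hsΦ z hz))
  obtain ⟨x, hx, hfix⟩ := hcont.exists_fixedPoint_Icc hab hφK
  have hxΦ : x ∈ Φ x := by simpa only [hfix] using hφ x hx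
  have hxmax : IsMaxOn (H x) (Φ x) x := by simpa only [hfix] using hφmax x hx
  exact ⟨x, hx, hxΦ, (hconc x hx).isMaxOn_of_isMaxOn_sub_sum_sq hxΦ hxmax⟩

end QuasiEquilibrium

section Market

open Set

/-- If changing `y i` to `v` does not increase `∑ k, f k (y k)`, then it does not increase its
`i`-th summand. -/
theorem Finset.sum_apply_le_of_sum_update_le {κ α : Type*} [Fintype κ] [DecidableEq κ]
    {f : κ → α → ℝ} {y : κ → α} {i : κ} {v : α}
    (h : ∑ k, f k (Function.update y i v k) ≤ ∑ k, f k (y k)) : f i v ≤ f i (y i) := by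
  by_contra! hlt
  refine h.not_gt (Finset.sum_lt_sum (fun k _ => ?_) ⟨i, Finset.mem_univ i, by simpa using hlt⟩)
  by_cases hk : k = i
  · subst hk; simpa using hlt.le
  · simp [hk]

/-- Existence of a competitive equilibrium when bundles are restricted to `[0, 2] ^ m`. -/
theorem exists_equilibrium_truncated
    (n m : ℕ)
    (u : Fin n → (Fin n → Fin m → ℝ) → ℝ)
    (b : Fin n → ℝ)
    (hb : ∀ i, 0 < b i)
    (hcont : ∀ i, ContinuousOn (u i) {X : Fin n → Fin m → ℝ | ∀ k j, 0 ≤ X k j})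
    (hconc : ∀ i (X : Fin n → Fin m → ℝ), (∀ k j, 0 ≤ X k j) →
      ConcaveOn ℝ {x : Fin m → ℝ | ∀ j, 0 ≤ x j}
        (fun x => u i (Function.update X i x))) :
    ∃ (X : Fin n → Fin m → ℝ) (p : Fin m → ℝ),
      (∀ k j, 0 ≤ X k j) ∧ (∀ j, 0 ≤ p j) ∧
      (∀ i, (∑ j, X i j * p j ≤ b i) ∧
        ∀ x : Fin m → ℝ, (∀ j, 0 ≤ x j) → (∀ j, x j ≤ 2) → (∑ j, x j * p j ≤ b i) →
          u i (Function.update X i x) ≤ u i X) ∧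
      (∀ j, ∑ i, X i j ≤ 1) ∧
      (∀ j, p j * ((∑ i, X i j) - 1) = 0) := by
  let P : ℝ := ∑ i, b i + 1
  have hP : 0 < P := by
    have : 0 ≤ ∑ i, b i := Finset.sum_nonneg fun i _ => (hb i).le
    positivity
  let ι := (Fin n × Fin m) ⊕ Fin m
  let lo : ι → ℝ := 0
  let hi : ι → ℝ := Sum.elim (fun _ => 2) (fun _ => P)
  have hlohi : lo ≤ hi := by
    rintro (k | j)
    · simp [lo, hi]
    · simpa [lo, hi] using hP.le
  let alloc : (ι → ℝ) → Fin n → Fin m → ℝ := fun x i j => x (Sum.inl (i, j))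
  let price : (ι → ℝ) → Fin m → ℝ := fun x j => x (Sum.inr j)
  have halloc : Continuous alloc := by fun_prop
  have hprice : Continuous price := by fun_prop
  have hK : ∀ x : ι → ℝ, x ∈ Icc lo hi ↔ (∀ i j, 0 ≤ alloc x i j ∧ alloc x i j ≤ 2) ∧
      ∀ j, 0 ≤ price x j ∧ price x j ≤ P := by
    intro x
    constructor
    · rintro ⟨h1, h2⟩
      exact ⟨fun i j => ⟨h1 (Sum.inl (i, j)), h2 (Sum.inl (i, j))⟩,
        fun j => ⟨h1 (Sum.inr j), h2 (Sum.inr j)⟩⟩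
    · rintro ⟨h1, h2⟩
      refine ⟨?_, ?_⟩ <;> rintro (⟨i, j⟩ | j)
      exacts [(h1 i j).1, (h2 j).1, (h1 i j).2, (h2 j).2]
  let Φ : (ι → ℝ) → Set (ι → ℝ) := fun x =>
    {y | y ∈ Icc lo hi ∧ ∀ i, ∑ j, alloc y i j * price x j ≤ b i}
  let F : (ι → ℝ) → (ι → ℝ) → ℝ := fun x y =>
    ∑ i, u i (Function.update (alloc x) i (alloc y i))
      + ∑ j, price y j * ((∑ i, alloc x i j) - 1)
  have hupd : ∀ {x y : ι → ℝ}, x ∈ Icc lo hi → y ∈ Icc lo hi → ∀ i k j,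
      0 ≤ Function.update (alloc x) i (alloc y i) k j := by
    intro x y hx hy i k j
    by_cases hk : k = i
    · subst hk; simpa using (((hK y).1 hy).1 k j).1
    · simpa [hk] using (((hK x).1 hx).1 k j).1
  obtain ⟨x, hx, hxΦ, hmax⟩ := exists_isMaxOn_self_of_concaveOn hlohi (Φ := Φ) (F := F)
    (fun x _ y hy => hy.1)
    (fun x _ => ⟨0, ⟨le_rfl, hlohi⟩, fun i => by simpa [alloc] using (hb i).le⟩)
    (by
      have h : {p : (ι → ℝ) × (ι → ℝ) | p.1 ∈ Icc lo hi ∧ p.2 ∈ Φ p.1}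
          = (Icc lo hi ×ˢ Icc lo hi) ∩
            ⋂ i, {p | ∑ j, alloc p.2 i j * price p.1 j ≤ b i} := by
        ext p
        simp only [Φ, mem_ofPred_eq, mem_inter_iff, mem_prod, mem_iInter, and_assoc]
      rw [h]
      refine (isClosed_Icc.prod isClosed_Icc).inter (isClosed_iInter fun i => ?_)
      exact isClosed_le (by fun_prop) continuous_const)
    (by
      intro x _ y hy
      let c : Fin n → (ι → ℝ) → ℝ := fun i z => b i / max (b i) (∑ j, alloc y i j * price z j)
      have hpos : ∀ i z, 0 < max (b i) (∑ j, alloc y i j * price z j) := fun i z =>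
        lt_max_of_lt_left (hb i)
      have hc0 : ∀ i z, 0 ≤ c i z := fun i z => div_nonneg (hb i).le (hpos i z).le
      have hc1 : ∀ i z, c i z ≤ 1 := fun i z => (div_le_one (hpos i z)).2 (le_max_left _ _)
      have hcc : ∀ i, Continuous (c i) := fun i =>
        continuous_const.div (by fun_prop) fun z => (hpos i z).ne'
      refine ⟨fun z => Sum.elim (fun k => c k.1 z * y (Sum.inl k)) (fun j => y (Sum.inr j)),
        ?_, ?_, fun z _ => ⟨(hK _).2 ⟨fun i j => ?_, fun j => ?_⟩, fun i => ?_⟩⟩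
      · refine Continuous.continuousWithinAt (continuous_pi ?_)
        rintro (k | j)
        · exact (hcc k.1).mul continuous_const
        · exact continuous_const
      · funext k
        rcases k with k | j
        · simp only [Sum.elim_inl, c]
          rw [max_eq_left (hy.2 k.1), div_self (hb k.1).ne', one_mul]
        · rfl
      · have h := ((hK y).1 hy.1).1 i j
        exact ⟨mul_nonneg (hc0 i z) h.1, (mul_le_of_le_one_left h.1 (hc1 i z)).trans h.2⟩
      · exact ((hK y).1 hy.1).2 j
      · have h : ∑ j, c i z * alloc y i j * price z j ≤ b i := by
          simp_rw [mul_assoc]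
          rw [← Finset.mul_sum, div_mul_eq_mul_div, div_le_iff₀ (hpos i z)]
          exact mul_le_mul_of_nonneg_left (le_max_right _ _) (hb i).le
        exact h)
    (by
      refine ContinuousOn.add (continuousOn_finsetSum _ fun i _ => ?_)
        (Continuous.continuousOn (by fun_prop))
      refine (hcont i).comp (f := fun p : (ι → ℝ) × (ι → ℝ) =>
        Function.update (alloc p.1) i (alloc p.2 i)) ?_ fun p hp => hupd hp.1 hp.2 i
      exact ((halloc.comp continuous_fst).update i (by fun_prop)).continuousOn)
    (by
      intro x hx
      have hx0 : ∀ k j, 0 ≤ alloc x k j := fun k j => (((hK x).1 hx).1 k j).1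
      refine ⟨fun y hy z hz s t hs ht hst => ⟨convex_Icc lo hi hy.1 hz.1 hs ht hst, fun i => ?_⟩,
        fun y hy z hz s t hs ht hst => ?_⟩
      · calc ∑ j, alloc (s • y + t • z) i j * price x j
            = s * ∑ j, alloc y i j * price x j + t * ∑ j, alloc z i j * price x j := by
              simp only [Finset.mul_sum, ← Finset.sum_add_distrib, alloc, Pi.add_apply,
                Pi.smul_apply, smul_eq_mul]
              exact Finset.sum_congr rfl fun j _ => by ring
          _ ≤ s * b i + t * b i := by
              gcongr
              · exact hy.2 i
              · exact hz.2 i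
          _ = b i := by rw [← add_mul, hst, one_mul]
      · have h1 : ∀ i, s * u i (Function.update (alloc x) i (alloc y i))
            + t * u i (Function.update (alloc x) i (alloc z i))
            ≤ u i (Function.update (alloc x) i (alloc (s • y + t • z) i)) := fun i =>
          (hconc i (alloc x) hx0).2 (fun j => (((hK y).1 hy.1).1 i j).1)
            (fun j => (((hK z).1 hz.1).1 i j).1) hs ht hst
        have h2 : ∑ j, price (s • y + t • z) j * ((∑ i, alloc x i j) - 1)
            = s * ∑ j, price y j * ((∑ i, alloc x i j) - 1)
              + t * ∑ j, price z j * ((∑ i, alloc x i j) - 1) := by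
          simp only [Finset.mul_sum, ← Finset.sum_add_distrib, price, Pi.add_apply,
            Pi.smul_apply, smul_eq_mul]
          exact Finset.sum_congr rfl fun j _ => by ring
        have h3 := Finset.sum_le_sum fun i (_ : i ∈ Finset.univ) => h1 i
        rw [Finset.sum_add_distrib, ← Finset.mul_sum, ← Finset.mul_sum] at h3
        simp only [F, smul_eq_mul]
        rw [h2]
        linarith)
  obtain ⟨hX, hp⟩ := (hK x).1 hx
  set X := alloc x with hXdef
  set p := price x with hpdef
  have hjoint : ∀ (Y : Fin n → Fin m → ℝ) (q : Fin m → ℝ), (∀ i j, 0 ≤ Y i j ∧ Y i j ≤ 2) →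
      (∀ j, 0 ≤ q j ∧ q j ≤ P) → (∀ i, ∑ j, Y i j * p j ≤ b i) →
      ∑ i, u i (Function.update X i (Y i)) + ∑ j, q j * ((∑ i, X i j) - 1)
        ≤ ∑ i, u i (Function.update X i (X i)) + ∑ j, p j * ((∑ i, X i j) - 1) := by
    intro Y q hY hq hYb
    exact hmax (show Sum.elim (fun k => Y k.1 k.2) q ∈ Φ x from ⟨(hK _).2 ⟨hY, hq⟩, hYb⟩)
  have hbudget : ∀ i, ∑ j, X i j * p j ≤ b i := hxΦ.2
  have hcp : ∀ j c, 0 ≤ c → c ≤ P → c * ((∑ i, X i j) - 1) ≤ p j * ((∑ i, X i j) - 1) := by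
    intro j c hc0 hcP
    have h := hjoint X (Function.update p j c) hX (fun k => by
      by_cases hk : k = j
      · subst hk; simpa using ⟨hc0, hcP⟩
      · simpa [hk] using hp k) hbudget
    exact Finset.sum_apply_le_of_sum_update_le
      (f := fun j c => c * ((∑ i, X i j) - 1)) (le_of_add_le_add_left h)
  have hfeas : ∀ j, ∑ i, X i j ≤ 1 := by
    intro j
    by_contra! hlt
    have h1 : P ≤ p j := le_of_mul_le_mul_right (hcp j P hP.le le_rfl) (sub_pos.2 hlt)
    have h2 : ∑ i, X i j * P ≤ ∑ i, b i := by
      refine Finset.sum_le_sum fun i _ => le_trans ?_ (hbudget i)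
      calc X i j * P ≤ X i j * p j := mul_le_mul_of_nonneg_left h1 (hX i j).1
        _ ≤ ∑ j, X i j * p j := Finset.single_le_sum
          (f := fun j => X i j * p j) (fun k _ => mul_nonneg (hX i k).1 (hp k).1)
          (Finset.mem_univ j)
    rw [← Finset.sum_mul] at h2
    have h3 : P < (∑ i, X i j) * P := lt_mul_of_one_lt_left hP hlt
    have h4 : P = ∑ i, b i + 1 := rfl
    linarith
  refine ⟨X, p, fun i j => (hX i j).1, fun j => (hp j).1, fun i => ⟨hbudget i, fun v hv0 hv2 hvb =>
    ?_⟩, hfeas, fun j => le_antisymm ?_ ?_⟩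
  · have h := hjoint (Function.update X i v) p (fun k => by
      by_cases hk : k = i
      · subst hk; simpa using fun j => ⟨hv0 j, hv2 j⟩
      · simpa [hk] using hX k) hp (fun k => by
      by_cases hk : k = i
      · subst hk; simpa using hvb
      · simpa [hk] using hbudget k)
    simpa using Finset.sum_apply_le_of_sum_update_le
      (f := fun i v => u i (Function.update X i v)) (le_of_add_le_add_right h)
  · exact mul_nonpos_of_nonneg_of_nonpos (hp j).1 (sub_nonpos.2 (hfeas j))
  · simpa using hcp j 0 le_rfl hP.le

end Market

/-- Every influence Fisher market with strictly positive budgets whose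
utilities are continuous, concave in the buyer's own bundle, and satisfy no
saturation has a competitive equilibrium. -/
theorem competitive_equilibrium_exists
    (n m : ℕ)
    (u : Fin n → (Fin n → Fin m → ℝ) → ℝ)
    (b : Fin n → ℝ)
    (hb : ∀ i, 0 < b i)
    (hcont : ∀ i, ContinuousOn (u i) {X : Fin n → Fin m → ℝ | ∀ k j, 0 ≤ X k j})
    (hconc : ∀ i (X : Fin n → Fin m → ℝ), (∀ k j, 0 ≤ X k j) →
      ConcaveOn ℝ {x : Fin m → ℝ | ∀ j, 0 ≤ x j}
        (fun x => u i (Function.update X i x)))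
    (hnosat : ∀ i (X : Fin n → Fin m → ℝ), (∀ k j, 0 ≤ X k j) →
      ∃ x' : Fin m → ℝ, (∀ j, 0 ≤ x' j) ∧ u i X < u i (Function.update X i x')) :
    ∃ (Xs : Fin n → Fin m → ℝ) (ps : Fin m → ℝ),
      (∀ k j, 0 ≤ Xs k j) ∧ (∀ j, 0 ≤ ps j) ∧
      -- each buyer maximizes utility over her budget set
      (∀ i, (∑ j, Xs i j * ps j ≤ b i) ∧
        ∀ x : Fin m → ℝ, (∀ j, 0 ≤ x j) → (∑ j, x j * ps j ≤ b i) →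
          u i (Function.update Xs i x) ≤ u i Xs) ∧
      -- feasibility
      (∀ j, ∑ i, Xs i j ≤ 1) ∧
      -- Walras' law
      (∑ j, ps j * ((∑ i, Xs i j) - 1) = 0) := by
  obtain ⟨X, p, hX, hp, hopt, hfeas, hwalras⟩ := exists_equilibrium_truncated n m u b hb hcont hconc
  refine ⟨X, p, hX, hp, fun i => ⟨(hopt i).1, fun v hv0 hvb => ?_⟩, hfeas,
    Finset.sum_eq_zero fun j _ => hwalras j⟩
  have hX1 : ∀ j, X i j ≤ 1 := fun j =>
    (Finset.single_le_sum (f := fun i => X i j) (fun k _ => hX k j) (Finset.mem_univ i)).trans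
      (hfeas j)
  have hS : 0 ≤ ∑ j, v j := Finset.sum_nonneg fun j _ => hv0 j
  set t : ℝ := 1 / (1 + ∑ j, v j) with ht
  have ht0 : 0 < t := by positivity
  have ht1 : t ≤ 1 := by rw [ht, div_le_one (by positivity)]; linarith
  have htv : ∀ j, t * v j ≤ 1 := fun j => by
    rw [ht, one_div_mul_eq_div, div_le_one (by positivity)]
    linarith [Finset.single_le_sum (fun k _ => hv0 k) (Finset.mem_univ j)]
  have hle := (hopt i).2 ((1 - t) • X i + t • v)
    (fun j => add_nonneg (mul_nonneg (by linarith) (hX i j)) (mul_nonneg ht0.le (hv0 j)))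
    (fun j => by
      have h1 : (1 - t) * X i j ≤ 1 :=
        mul_le_one₀ (by linarith) (hX i j) (hX1 j)
      simpa using (add_le_add h1 (htv j)).trans_eq one_add_one_eq_two)
    (by
      calc ∑ j, ((1 - t) • X i + t • v) j * p j
          = (1 - t) * ∑ j, X i j * p j + t * ∑ j, v j * p j := by
            simp only [Finset.mul_sum, ← Finset.sum_add_distrib, Pi.add_apply, Pi.smul_apply,
              smul_eq_mul]
            exact Finset.sum_congr rfl fun j _ => by ring
        _ ≤ (1 - t) * b i + t * b i :=
            add_le_add (mul_le_mul_of_nonneg_left (hopt i).1 (by linarith))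
              (mul_le_mul_of_nonneg_left hvb ht0.le)
        _ = b i := by ring)
  have hcv := (hconc i X hX).2 (hX i) hv0 (sub_nonneg.2 ht1) ht0.le (sub_add_cancel 1 t)
  simp only [smul_eq_mul, Function.update_eq_self] at hcv
  nlinarith
end

section
/- Let (G,u,b) be an influence Fisher market with n buyers and m goods in which every budget b_i is strictly positive and, for every buyer i, u_i is continuous and is concave, continuously differentiable, and homogeneous of degree one in x_i for every fixed X_{-i}. Let X* ∈ ℝ_{≥0}^{n×m} satisfy Σ_i x*_{ij} ≤ 1 for every good j and u_i(x*_i, X*_{-i}) > 0 for every i, and suppose there exist p* ∈ ℝ_{≥0}^m and, for each buyer i, μ*_i ∈ ℝ_{≥0}^m, satisfying for every i and every good j the KKT conditions: (stationarity) (b_i / u_i(x*_i, X*_{-i})) · ∂u_i/∂x_{ij}(X*) − p*_j + μ*_{ij} = 0; (complementary slackness) p*_j (Σ_k x*_{kj} − 1) = 0 and μ*_{ij} x*_{ij} = 0. Then (X*, p*) is a competitive equilibrium of the market. -/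
open Finset

/-- The first-order (tangent) inequality for a concave function differentiable within its domain. -/
theorem ConcaveOn.sub_le_of_hasFDerivWithinAt {E : Type*} [NormedAddCommGroup E]
    [NormedSpace ℝ E] {S : Set E} {f : E → ℝ} {L : E →L[ℝ] ℝ} {x y : E}
    (hf : ConcaveOn ℝ S f) (hL : HasFDerivWithinAt f L S x) (hx : x ∈ S) (hy : y ∈ S) :
    f y - f x ≤ L (y - x) := by
  have hmaps : Set.MapsTo (AffineMap.lineMap x y : ℝ → E) (Set.Icc 0 1) S :=
    fun t ht => hf.1.lineMap_mem hx hy ht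
  have hline : HasDerivWithinAt (AffineMap.lineMap x y : ℝ → E) (y - x) (Set.Icc (0 : ℝ) 1) 0 :=
    AffineMap.hasDerivWithinAt_lineMap
  have hderiv : HasDerivWithinAt (f ∘ (AffineMap.lineMap x y : ℝ → E)) (L (y - x))
      (Set.Icc (0 : ℝ) 1) 0 :=
    HasFDerivWithinAt.comp_hasDerivWithinAt (t := S) 0 (by simpa using hL) hline hmaps
  have hconc : ConcaveOn ℝ (Set.Icc (0 : ℝ) 1) (f ∘ (AffineMap.lineMap x y : ℝ → E)) :=
    (hf.comp_affineMap (AffineMap.lineMap x y)).subset hmaps (convex_Icc 0 1)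
  simpa [slope] using hconc.slope_le_of_hasDerivWithinAt (x := 0) (y := 1)
    (by simp) (by simp) one_pos hderiv

/-- For a concave, positively homogeneous function, the derivative at a point of a cone agrees
with the function there (Euler's identity) and dominates it on the whole cone. -/
theorem ConcaveOn.euler_and_le_of_homogeneous {E : Type*} [NormedAddCommGroup E]
    [NormedSpace ℝ E] {S : Set E} {f : E → ℝ} {L : E →L[ℝ] ℝ} {x : E}
    (hf : ConcaveOn ℝ S f) (hL : HasFDerivWithinAt f L S x) (hx : x ∈ S)
    (hS : ∀ c : ℝ, 0 ≤ c → c • x ∈ S) (hhom : ∀ c : ℝ, 0 ≤ c → f (c • x) = c * f x) :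
    L x = f x ∧ ∀ y ∈ S, f y ≤ L y := by
  have h0 := hf.sub_le_of_hasFDerivWithinAt hL hx (hS 0 le_rfl)
  have h2 := hf.sub_le_of_hasFDerivWithinAt hL hx (hS 2 zero_le_two)
  rw [hhom 0 le_rfl, map_sub, map_smul, smul_eq_mul] at h0
  rw [hhom 2 zero_le_two, map_sub, map_smul, smul_eq_mul] at h2
  have hEuler : L x = f x := by linarith
  refine ⟨hEuler, fun y hy => ?_⟩
  have := hf.sub_le_of_hasFDerivWithinAt hL hx hy
  rw [map_sub] at this
  linarith

/-- If a nonnegative, feasible allocation `X*` together with nonnegative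
prices `p*` and nonnegative multipliers `μ*` satisfies the KKT stationarity and
complementary-slackness conditions of the buyer pseudo-game (utilities being
continuous, and concave, continuously differentiable and homogeneous of degree one
in the buyer's own bundle, with positive utilities at `X*` and positive budgets),
then `(X*, p*)` is a competitive equilibrium. -/
theorem KKT_implies_competitive_equilibrium
    (n m : ℕ)
    (u : Fin n → (Fin n → Fin m → ℝ) → ℝ)
    (b : Fin n → ℝ)
    (hb : ∀ i, 0 < b i)
    (hcont : ∀ i, ContinuousOn (u i) {X : Fin n → Fin m → ℝ | ∀ k j, 0 ≤ X k j})
    (hconc : ∀ i (X : Fin n → Fin m → ℝ), (∀ k j, 0 ≤ X k j) →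
      ConcaveOn ℝ {x : Fin m → ℝ | ∀ j, 0 ≤ x j}
        (fun x => u i (Function.update X i x)))
    (hC1 : ∀ i (X : Fin n → Fin m → ℝ), (∀ k j, 0 ≤ X k j) →
      ContDiffOn ℝ 1 (fun x => u i (Function.update X i x)) {x : Fin m → ℝ | ∀ j, 0 ≤ x j})
    (hhom : ∀ i (X : Fin n → Fin m → ℝ), (∀ k j, 0 ≤ X k j) →
      ∀ (x : Fin m → ℝ), (∀ j, 0 ≤ x j) → ∀ c : ℝ, 0 ≤ c →
        u i (Function.update X i (c • x)) = c * u i (Function.update X i x))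
    (Xs : Fin n → Fin m → ℝ)
    (hXs : ∀ k j, 0 ≤ Xs k j)
    (hfeas : ∀ j, ∑ i, Xs i j ≤ 1)
    (hupos : ∀ i, 0 < u i Xs)
    (ps : Fin m → ℝ) (hps : ∀ j, 0 ≤ ps j)
    (μs : Fin n → Fin m → ℝ) (hμs : ∀ i j, 0 ≤ μs i j)
    -- KKT stationarity, where the partial derivative ∂u_i/∂x_{ij}(X*) is the
    -- derivative of buyer i's utility in her own bundle within ℝ_{≥0}^m at x*_i
    (hstat : ∀ i j,
      (b i / u i Xs) *
        (fderivWithin ℝ (fun x => u i (Function.update Xs i x))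
          {x : Fin m → ℝ | ∀ j, 0 ≤ x j} (Xs i) (Pi.single j 1))
        - ps j + μs i j = 0)
    -- complementary slackness
    (hcs₁ : ∀ j, ps j * ((∑ k, Xs k j) - 1) = 0)
    (hcs₂ : ∀ i j, μs i j * Xs i j = 0) :
    -- (X*, p*) is a competitive equilibrium
    (∀ i, (∑ j, Xs i j * ps j ≤ b i) ∧
      ∀ x : Fin m → ℝ, (∀ j, 0 ≤ x j) → (∑ j, x j * ps j ≤ b i) →
        u i (Function.update Xs i x) ≤ u i Xs) ∧
    (∀ j, ∑ i, Xs i j ≤ 1) ∧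
    (∑ j, ps j * ((∑ i, Xs i j) - 1) = 0) := by
  refine ⟨fun i => ?_, hfeas, Finset.sum_eq_zero fun j _ => hcs₁ j⟩
  set S : Set (Fin m → ℝ) := {x | ∀ j, 0 ≤ x j}
  set f : (Fin m → ℝ) → ℝ := fun x => u i (Function.update Xs i x) with hf
  set L := fderivWithin ℝ f S (Xs i)
  have hfX : f (Xs i) = u i Xs := by simp [hf]
  have hL : HasFDerivWithinAt f L S (Xs i) :=
    ((hC1 i Xs hXs).differentiableOn one_ne_zero (Xs i) (hXs i)).hasFDerivWithinAt
  obtain ⟨hEuler, hle⟩ := (hconc i Xs hXs).euler_and_le_of_homogeneous hL (hXs i)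
    (fun c hc j => mul_nonneg hc (hXs i j)) (fun c hc => hhom i Xs hXs (Xs i) (hXs i) c hc)
  have hLu : L (Xs i) = u i Xs := hEuler.trans hfX
  have hu := hupos i
  have hexpand (v : Fin m → ℝ) :
      b i / u i Xs * L v = ∑ j, v j * ps j - ∑ j, μs i j * v j := by
    conv_lhs => rw [pi_eq_sum_univ' v]
    rw [map_sum, Finset.mul_sum, ← Finset.sum_sub_distrib]
    refine Finset.sum_congr rfl fun j _ => ?_
    rw [map_smul, smul_eq_mul]
    linear_combination v j * hstat i j
  constructor
  · have h := hexpand (Xs i)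
    rw [hLu, div_mul_cancel₀ _ hu.ne', Finset.sum_eq_zero fun j _ => hcs₂ i j] at h
    linarith
  · intro x hx hbudget
    have hμx : 0 ≤ ∑ j, μs i j * x j :=
      Finset.sum_nonneg fun j _ => mul_nonneg (hμs i j) (hx j)
    have h : b i / u i Xs * L x ≤ b i := by rw [hexpand]; linarith
    rw [div_mul_eq_mul_div, div_le_iff₀ hu] at h
    exact (hle x hx).trans (le_of_mul_le_mul_left h (hb i))
end

section
/- Fix a buyer with budget b > 0, prices p ∈ ℝ^m with p_j > 0 for every j, and fixed neighbor allocations X_N. Suppose x ↦ u(x, X_N), defined on ℝ_{≥0}^m, is continuous, concave, and homogeneous of degree one, and that u(x̂, X_N) > 0 for some x̂ ∈ ℝ_{≥0}^m. Then the constrained and penalized problems have the same optimal value: sup { b log u(x, X_N) : x ∈ ℝ_{≥0}^m, x · p ≤ b } = sup { b log u(x, X_N) + b − x · p : x ∈ ℝ_{≥0}^m }, where log is extended by log t = −∞ for t ≤ 0. -/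
open Finset

/-- The extended-real logarithm: `log t = −∞` for `t ≤ 0`. -/
noncomputable def elog (t : ℝ) : EReal :=
  if t ≤ 0 then ⊥ else ((Real.log t : ℝ) : EReal)

/-- Rescaling a bundle of cost `s` to cost exactly `b` gains at least the unspent budget. -/
lemma mul_log_add_sub_le_mul_log_div_mul {b s t : ℝ} (hb : 0 < b) (hs : 0 < s) (ht : 0 < t) :
    b * Real.log t + (b - s) ≤ b * Real.log (b / s * t) := by
  rw [Real.log_mul (div_pos hb hs).ne' ht.ne']
  have h := Real.log_le_sub_one_of_pos (div_pos hs hb)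
  rw [← inv_div, Real.log_inv] at h
  have h2 := mul_le_mul_of_nonneg_left h hb.le
  have h3 : b * ((b / s)⁻¹ - 1) = s - b := by field_simp
  rw [h3] at h2
  linarith

lemma elog_of_nonpos {t : ℝ} (ht : t ≤ 0) : elog t = ⊥ := if_pos ht

lemma elog_of_pos {t : ℝ} (ht : 0 < t) : elog t = (Real.log t : ℝ) := if_neg ht.not_ge

/-- For a continuous, concave, degree-one homogeneous utility that is
positive somewhere on the nonnegative orthant, a positive budget and strictly
positive prices, the budget-constrained problem and the budget-penalized problem
have the same optimal value:
`sup { b log u(x) : x ≥ 0, x·p ≤ b } = sup { b log u(x) + b − x·p : x ≥ 0 }`. -/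
theorem constrained_eq_penalized
    (m : ℕ) (u : (Fin m → ℝ) → ℝ) (b : ℝ) (hb : 0 < b)
    (p : Fin m → ℝ) (hp : ∀ j, 0 < p j)
    (hcont : ContinuousOn u {x : Fin m → ℝ | ∀ j, 0 ≤ x j})
    (hconc : ConcaveOn ℝ {x : Fin m → ℝ | ∀ j, 0 ≤ x j} u)
    (hhom : ∀ c : ℝ, 0 ≤ c → ∀ x : Fin m → ℝ, (∀ j, 0 ≤ x j) → u (c • x) = c * u x)
    (hpos : ∃ x : Fin m → ℝ, (∀ j, 0 ≤ x j) ∧ 0 < u x) :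
    (⨆ x : {x : Fin m → ℝ // (∀ j, 0 ≤ x j) ∧ ∑ j, x j * p j ≤ b},
        (b : EReal) * elog (u x.1))
    =
    (⨆ x : {x : Fin m → ℝ // ∀ j, 0 ≤ x j},
        (b : EReal) * elog (u x.1) + ((b - ∑ j, x.1 j * p j : ℝ) : EReal)) := by
  apply le_antisymm
  · refine iSup_le fun ⟨x, hx, hxb⟩ => ?_
    refine le_trans ?_ (le_iSup _ (⟨x, hx⟩ : {x : Fin m → ℝ // ∀ j, 0 ≤ x j}))
    exact le_add_of_nonneg_right (EReal.coe_nonneg.2 (sub_nonneg.2 hxb))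
  · refine iSup_le fun ⟨x, hx⟩ => ?_
    dsimp only
    rcases le_or_gt (u x) 0 with hu | hu
    · rw [elog_of_nonpos hu, EReal.coe_mul_bot_of_pos hb, EReal.bot_add]
      exact bot_le
    have hterm : ∀ j ∈ univ, 0 ≤ x j * p j := fun j _ => mul_nonneg (hx j) (hp j).le
    have hs : 0 < ∑ j, x j * p j := by
      refine (sum_nonneg hterm).lt_of_ne' fun h0 => hu.ne' ?_
      have hx0 : x = (0 : ℝ) • x := by
        ext j
        have := (sum_eq_zero_iff_of_nonneg hterm).1 h0 j (mem_univ j)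
        simpa [(hp j).ne'] using this
      rw [hx0, hhom 0 le_rfl x hx, zero_mul]
    have hc : 0 < b / ∑ j, x j * p j := div_pos hb hs
    have hcost : ∑ j, ((b / ∑ j, x j * p j) • x) j * p j ≤ b := by
      simp only [Pi.smul_apply, smul_eq_mul, mul_assoc]
      rw [← mul_sum, div_mul_cancel₀ _ hs.ne']
    refine le_trans ?_ (le_iSup _
      (⟨(b / ∑ j, x j * p j) • x, fun j => mul_nonneg hc.le (hx j), hcost⟩ :
        {x : Fin m → ℝ // (∀ j, 0 ≤ x j) ∧ ∑ j, x j * p j ≤ b}))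
    dsimp only
    rw [hhom _ hc.le x hx, elog_of_pos hu, elog_of_pos (mul_pos hc hu)]
    exact_mod_cast mul_log_add_sub_le_mul_log_div_mul hb hs hu
end

section
/- Fix a buyer i with budget b_i > 0, fixed allocations x*_k ∈ ℝ_{≥0}^m for every other buyer k ≠ i, and prices p ∈ ℝ^m with p_j > 0 for every j. Suppose x ↦ u_i(x, X*_{-i}), defined on ℝ_{≥0}^m, is continuous, concave, and homogeneous of degree one, and u_i(x̂, X*_{-i}) > 0 for some x̂ ∈ ℝ_{≥0}^m. Then the Lagrangian dual function g_i(p) := sup { b_i log u_i(x, X*_{-i}) + Σ_j p_j (1 − x_j − Σ_{k≠i} x*_{kj}) : x ∈ ℝ_{≥0}^m } satisfies g_i(p) = Σ_j p_j (1 − Σ_{k≠i} x*_{kj}) − b_i + sup { b_i log u_i(x, X*_{-i}) : x ∈ ℝ_{≥0}^m, x · p ≤ b_i }. -/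
open Finset

theorem coe_mul_elog_of_nonpos {b t : ℝ} (hb : 0 < b) (ht : t ≤ 0) :
    (b : EReal) * elog t = ⊥ := by
  rw [elog, if_pos ht, EReal.coe_mul_bot_of_pos hb]

theorem coe_mul_elog_of_pos (b : ℝ) {t : ℝ} (ht : 0 < t) :
    (b : EReal) * elog t = ((b * Real.log t : ℝ) : EReal) := by
  rw [elog, if_neg ht.not_ge, EReal.coe_mul]

/-- Log utility with a linear spending penalty is dominated by log utility after rescaling
the spending `s` to the budget `b`. -/
theorem mul_log_sub_le_mul_log_rescale {b s t : ℝ} (hb : 0 < b) (hs : 0 < s) (ht : 0 < t) :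
    b * Real.log t - s ≤ b * Real.log (b / s * t) - b := by
  have h := mul_le_mul_of_nonneg_left (Real.log_le_sub_one_of_pos (div_pos hs hb)) hb.le
  rw [mul_sub, mul_div_cancel₀ _ hb.ne', Real.log_div hs.ne' hb.ne'] at h
  rw [Real.log_mul (div_pos hb hs).ne' ht.ne', Real.log_div hb.ne' hs.ne']
  linarith

/-- A nonnegative bundle of positive degree-one homogeneous utility costs a positive amount
at positive prices. -/
theorem sum_mul_pos_of_utility_pos {m : ℕ} {u : (Fin m → ℝ) → ℝ}
    (hhom : ∀ c : ℝ, 0 ≤ c → ∀ x : Fin m → ℝ, (∀ j, 0 ≤ x j) → u (c • x) = c * u x)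
    {p x : Fin m → ℝ} (hp : ∀ j, 0 < p j) (hx : ∀ j, 0 ≤ x j) (hu : 0 < u x) :
    0 < ∑ j, x j * p j := by
  have hterm : ∀ j ∈ univ, 0 ≤ x j * p j := fun j _ => mul_nonneg (hx j) (hp j).le
  refine (sum_nonneg hterm).lt_of_ne fun h => hu.ne' ?_
  have hx0 : x = 0 := by
    ext j
    exact (mul_eq_zero.1 ((sum_eq_zero_iff_of_nonneg hterm).1 h.symm j (mem_univ j))).resolve_right
      (hp j).ne'
  simpa [hx0] using hhom 0 le_rfl x hx

/-- For a continuous, concave, degree-one homogeneous utility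
`u = u_i(·, X*_{-i})` of buyer `i` (positive somewhere), a positive budget and
strictly positive prices, the Lagrangian dual function of buyer i's supply-constrained
utility-maximization problem equals the discounted price sum minus the budget plus
the optimal value of the budget-constrained problem. -/
theorem lagrangian_dual_of_buyer_problem
    (n m : ℕ) (i : Fin n) (b : ℝ) (hb : 0 < b)
    (xstar : Fin n → Fin m → ℝ)
    (hxstar : ∀ k, k ≠ i → ∀ j, 0 ≤ xstar k j)
    (u : (Fin m → ℝ) → ℝ)
    (hcont : ContinuousOn u {x : Fin m → ℝ | ∀ j, 0 ≤ x j})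
    (hconc : ConcaveOn ℝ {x : Fin m → ℝ | ∀ j, 0 ≤ x j} u)
    (hhom : ∀ c : ℝ, 0 ≤ c → ∀ x : Fin m → ℝ, (∀ j, 0 ≤ x j) → u (c • x) = c * u x)
    (hpos : ∃ x : Fin m → ℝ, (∀ j, 0 ≤ x j) ∧ 0 < u x)
    (p : Fin m → ℝ) (hp : ∀ j, 0 < p j) :
    -- the Lagrangian dual function g_i(p)
    (⨆ x : {x : Fin m → ℝ // ∀ j, 0 ≤ x j},
        (b : EReal) * elog (u x.1)
          + ((∑ j, p j * (1 - x.1 j - ∑ k ∈ Finset.univ.erase i, xstar k j) : ℝ) : EReal))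
    =
    ((∑ j, p j * (1 - ∑ k ∈ Finset.univ.erase i, xstar k j) - b : ℝ) : EReal)
      + (⨆ x : {x : Fin m → ℝ // (∀ j, 0 ≤ x j) ∧ ∑ j, x j * p j ≤ b},
          (b : EReal) * elog (u x.1)) := by
  have hsum : ∀ x : Fin m → ℝ,
      ∑ j, p j * (1 - x j - ∑ k ∈ Finset.univ.erase i, xstar k j)
        = ∑ j, p j * (1 - ∑ k ∈ Finset.univ.erase i, xstar k j) - ∑ j, x j * p j := by
    intro x
    rw [← sum_sub_distrib]
    exact sum_congr rfl fun j _ => by ring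
  simp only [hsum]
  generalize ∑ j, p j * (1 - ∑ k ∈ Finset.univ.erase i, xstar k j) = C
  apply le_antisymm
  · refine iSup_le fun ⟨x, hx⟩ => ?_
    rcases le_or_gt (u x) 0 with hu | hu
    · simp [coe_mul_elog_of_nonpos hb hu]
    have hs := sum_mul_pos_of_utility_pos hhom hp hx hu
    set s := ∑ j, x j * p j with hsdef
    have hc : 0 < b / s := div_pos hb hs
    have hy : (∀ j, 0 ≤ ((b / s) • x) j) ∧ ∑ j, ((b / s) • x) j * p j ≤ b := by
      refine ⟨fun j => mul_nonneg hc.le (hx j), le_of_eq ?_⟩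
      simp only [Pi.smul_apply, smul_eq_mul, mul_assoc, ← mul_sum]
      rw [← hsdef, div_mul_cancel₀ _ hs.ne']
    refine le_trans ?_ (add_le_add_right (le_iSup (fun x : {x : Fin m → ℝ //
      (∀ j, 0 ≤ x j) ∧ ∑ j, x j * p j ≤ b} => (b : EReal) * elog (u x.1)) ⟨_, hy⟩) _)
    simp only
    rw [hhom _ hc.le x hx, coe_mul_elog_of_pos b hu, coe_mul_elog_of_pos b (mul_pos hc hu),
      ← EReal.coe_add, ← EReal.coe_add, EReal.coe_le_coe_iff]
    linarith [mul_log_sub_le_mul_log_rescale hb hs hu]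
  · rw [add_comm, ← EReal.le_sub_iff_add_le (.inl (EReal.coe_ne_bot _))
      (.inl (EReal.coe_ne_top _))]
    refine iSup_le fun ⟨x, hx, hxb⟩ => ?_
    rw [EReal.le_sub_iff_add_le (.inl (EReal.coe_ne_bot _)) (.inl (EReal.coe_ne_top _))]
    refine le_iSup_of_le ⟨x, hx⟩ (add_le_add_right ?_ _)
    exact EReal.coe_le_coe_iff.2 (by linarith)
end

section
/- Fix a buyer i with budget b_i > 0 and fixed allocations x*_k ∈ ℝ_{≥0}^m for every other buyer k ≠ i, and suppose x ↦ u_i(x, X*_{-i}), defined on ℝ_{≥0}^m, is continuous, concave, and homogeneous of degree one, with u_i(x̂, X*_{-i}) > 0 for some x̂ ∈ ℝ_{≥0}^m. Then the auctioneer's value function p ↦ V_i(p) is convex on the set {p ∈ ℝ^m : p_j > 0 for all j}. -/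
open Finset

/-- The auctioneer's value function in buyer `i`'s Stackelberg game, where
`u = u_i(·, X*_{-i})` and `other j = Σ_{k≠i} x*_{kj}`. -/
noncomputable def Vfun (m : ℕ) (u : (Fin m → ℝ) → ℝ) (b : ℝ)
    (other : Fin m → ℝ) (p : Fin m → ℝ) : EReal :=
  ⨆ x : {x : Fin m → ℝ // (∀ j, 0 ≤ x j) ∧ ∑ j, x j * p j ≤ b},
    ((∑ j, p j * (1 - other j) : ℝ) : EReal) + (b : EReal) * elog (u x.1)

/-- A feasible bundle with positive utility bounds the value function from below. -/
theorem le_Vfun {m : ℕ} {u : (Fin m → ℝ) → ℝ} {b : ℝ} {other p x : Fin m → ℝ}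
    (hx : ∀ j, 0 ≤ x j) (hxp : ∑ j, x j * p j ≤ b) (hu : 0 < u x) :
    ((∑ j, p j * (1 - other j) + b * Real.log (u x) : ℝ) : EReal) ≤ Vfun m u b other p := by
  unfold Vfun
  refine le_trans (le_of_eq ?_) (le_iSup _ ⟨x, hx, hxp⟩)
  simp [elog, not_le.mpr hu]

/-- Rescaling a bundle of positive cost so that it exhausts the budget bounds the value
function of a homogeneous utility from below. -/
theorem le_Vfun_of_homogeneous {m : ℕ} {u : (Fin m → ℝ) → ℝ} {b : ℝ} {other p x : Fin m → ℝ}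
    (hb : 0 < b)
    (hhom : ∀ c : ℝ, 0 ≤ c → ∀ x : Fin m → ℝ, (∀ j, 0 ≤ x j) → u (c • x) = c * u x)
    (hx : ∀ j, 0 ≤ x j) (hu : 0 < u x) (hs : 0 < ∑ j, x j * p j) :
    ((∑ j, p j * (1 - other j)
      + b * (Real.log b - Real.log (∑ j, x j * p j) + Real.log (u x)) : ℝ) : EReal)
      ≤ Vfun m u b other p := by
  set s := ∑ j, x j * p j with hsdef
  have hbs : 0 < b / s := div_pos hb hs
  have huy : u ((b / s) • x) = b / s * u x := hhom _ hbs.le x hx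
  have hcost : ∑ j, ((b / s) • x) j * p j ≤ b := by
    simp only [Pi.smul_apply, smul_eq_mul, mul_assoc, ← Finset.mul_sum]
    rw [← hsdef, div_mul_cancel₀ _ hs.ne']
  have h := le_Vfun (u := u) (b := b) (other := other) (p := p) (x := (b / s) • x)
    (fun j => mul_nonneg hbs.le (hx j)) hcost (by rw [huy]; positivity)
  rwa [huy, Real.log_mul hbs.ne' hu.ne', Real.log_div hb.ne' hs.ne'] at h

/-- A bundle of positive utility has positive cost at positive prices. -/
theorem cost_pos_of_homogeneous {m : ℕ} {u : (Fin m → ℝ) → ℝ} {p x : Fin m → ℝ}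
    (hhom : ∀ c : ℝ, 0 ≤ c → ∀ x : Fin m → ℝ, (∀ j, 0 ≤ x j) → u (c • x) = c * u x)
    (hx : ∀ j, 0 ≤ x j) (hu : 0 < u x) (hp : ∀ j, 0 < p j) : 0 < ∑ j, x j * p j := by
  obtain ⟨j, hj⟩ : ∃ j, x j ≠ 0 := by
    by_contra! h
    have h0 := hhom 0 le_rfl x hx
    rw [zero_smul, zero_mul, ← show x = 0 from funext h] at h0
    exact hu.ne' h0
  exact Finset.sum_pos' (fun k _ => mul_nonneg (hx k) (hp k).le)
    ⟨j, Finset.mem_univ j, mul_pos ((hx j).lt_of_ne' hj) (hp j)⟩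

/-- For a continuous, concave, degree-one homogeneous utility with a
strictly positive value somewhere on the nonnegative orthant and a positive budget,
the auctioneer's value function `V_i` is convex on the strictly positive orthant. -/
theorem value_function_convex
    (n m : ℕ) (i : Fin n) (b : ℝ) (hb : 0 < b)
    (xstar : Fin n → Fin m → ℝ)
    (hxstar : ∀ k, k ≠ i → ∀ j, 0 ≤ xstar k j)
    (u : (Fin m → ℝ) → ℝ)
    (hcont : ContinuousOn u {x : Fin m → ℝ | ∀ j, 0 ≤ x j})
    (hconc : ConcaveOn ℝ {x : Fin m → ℝ | ∀ j, 0 ≤ x j} u)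
    (hhom : ∀ c : ℝ, 0 ≤ c → ∀ x : Fin m → ℝ, (∀ j, 0 ≤ x j) → u (c • x) = c * u x)
    (hpos : ∃ xhat : Fin m → ℝ, (∀ j, 0 ≤ xhat j) ∧ 0 < u xhat) :
    ∀ p q : Fin m → ℝ, (∀ j, 0 < p j) → (∀ j, 0 < q j) →
      ∀ a c : ℝ, 0 ≤ a → 0 ≤ c → a + c = 1 →
        Vfun m u b (fun j => ∑ k ∈ Finset.univ.erase i, xstar k j)
            (fun j => a * p j + c * q j)
          ≤ (a : EReal) * Vfun m u b (fun j => ∑ k ∈ Finset.univ.erase i, xstar k j) p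
            + (c : EReal) * Vfun m u b (fun j => ∑ k ∈ Finset.univ.erase i, xstar k j) q := by
  intro p q hp hq a c ha hc hac
  generalize (fun j => ∑ k ∈ Finset.univ.erase i, xstar k j) = other
  conv_lhs => unfold Vfun
  refine iSup_le ?_
  rintro ⟨x, hx, hxr⟩
  by_cases hu : u x ≤ 0
  · simp [elog, hu, EReal.coe_mul_bot_of_pos hb]
  have hux : 0 < u x := not_le.mp hu
  have hs := cost_pos_of_homogeneous hhom hx hux hp
  have ht := cost_pos_of_homogeneous hhom hx hux hq
  have hVp := le_Vfun_of_homogeneous (other := other) hb hhom hx hux hs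
  have hVq := le_Vfun_of_homogeneous (other := other) hb hhom hx hux ht
  refine le_trans ?_ (add_le_add
    (mul_le_mul_of_nonneg_left hVp (EReal.coe_nonneg.mpr ha))
    (mul_le_mul_of_nonneg_left hVq (EReal.coe_nonneg.mpr hc)))
  simp only [elog, if_neg hu]
  norm_cast
  have hcost : ∑ j, x j * (a * p j + c * q j)
      = a * ∑ j, x j * p j + c * ∑ j, x j * q j := by
    rw [Finset.mul_sum, Finset.mul_sum, ← Finset.sum_add_distrib]
    exact Finset.sum_congr rfl fun j _ => by ring
  have hlin : ∑ j, (a * p j + c * q j) * (1 - other j)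
      = a * ∑ j, p j * (1 - other j) + c * ∑ j, q j * (1 - other j) := by
    rw [Finset.mul_sum, Finset.mul_sum, ← Finset.sum_add_distrib]
    exact Finset.sum_congr rfl fun j _ => by ring
  rw [hcost] at hxr
  rw [hlin]
  generalize ∑ j, x j * p j = s at *
  generalize ∑ j, x j * q j = t at *
  have hjensen : a * Real.log s + c * Real.log t ≤ Real.log (a * s + c * t) :=
    strictConcaveOn_log_Ioi.concaveOn.2 hs ht ha hc hac
  have hmean : 0 < a * s + c * t := (convex_Ioi (0 : ℝ)) hs ht ha hc hac
  have hlog := mul_le_mul_of_nonneg_left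
    (hjensen.trans (Real.log_le_log hmean hxr)) hb.le
  obtain rfl : c = 1 - a := by linarith
  linarith
end
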